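/- For m ∈ ℝ, consider the polynomials P_m(x,y) = −2y + (3m−4)x + (4−2m)x³ + x·y² − x⁵, Q_m(x,y) = (4−m)x + x·y² − 2m·x³ − x⁵, and H_m(x,y) = y² − (x² + m − 2)². Then for m = 0 and for m = 1, the polynomial ∂H_m/∂x · P_m + ∂H_m/∂y · Q_m is divisible by H_m in ℝ[x,y]; consequently, for these values of m the algebraic curve {H_m = 0} is invariant under the flow of the vector field (P_m, Q_m), and this curve contains the saddle equilibria (±√(2−m), 0), i.e. P_m and Q_m both vanish at (±√(2−m), 0) and H_m(±√(2−m), 0) = 0. -/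

import Mathlib

open MvPolynomial

noncomputable section

/-- `P_m(x,y) = −2y + (3m−4)x + (4−2m)x³ + x·y² − x⁵`. -/
def Pm (m : ℝ) : MvPolynomial (Fin 2) ℝ :=
  C (-2) * X 1 + C (3 * m - 4) * X 0 + C (4 - 2 * m) * X 0 ^ 3
    + X 0 * X 1 ^ 2 - X 0 ^ 5

/-- `Q_m(x,y) = (4−m)x + x·y² − 2m·x³ − x⁵`. -/
def Qm (m : ℝ) : MvPolynomial (Fin 2) ℝ :=
  C (4 - m) * X 0 + X 0 * X 1 ^ 2 - C (2 * m) * X 0 ^ 3 - X 0 ^ 5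

/-- `H_m(x,y) = y² − (x² + m − 2)²`. -/
def Hm (m : ℝ) : MvPolynomial (Fin 2) ℝ :=
  X 1 ^ 2 - (X 0 ^ 2 + C (m - 2)) ^ 2

theorem Pm_eq {m : ℝ} (hm : m ^ 2 = m) : Pm m = C (-2) * X 1 + X 0 * Hm m := by
  have h : (C m : MvPolynomial (Fin 2) ℝ) ^ 2 = C m := by rw [← C_pow, hm]
  simp only [Pm, Hm, map_sub, map_mul, map_neg, map_ofNat]
  linear_combination X 0 * h

theorem Qm_eq {m : ℝ} (hm : m ^ 2 = m) :
    Qm m = X 0 * Hm m - C 4 * X 0 * (X 0 ^ 2 + C (m - 2)) := by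
  have h : (C m : MvPolynomial (Fin 2) ℝ) ^ 2 = C m := by rw [← C_pow, hm]
  simp only [Qm, Hm, map_sub, map_mul, map_ofNat]
  linear_combination X 0 * h

theorem pderiv_zero_Hm (m : ℝ) :
    pderiv (0 : Fin 2) (Hm m) = -(C 4 * X 0 * (X 0 ^ 2 + C (m - 2))) := by
  simp only [Hm, map_sub, map_add, Derivation.leibniz_pow, pderiv_X_self, pderiv_C,
    pderiv_X_of_ne (show (1 : Fin 2) ≠ 0 by decide), smul_eq_mul, nsmul_eq_mul]
  simp only [map_ofNat]
  push_cast
  ring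

theorem pderiv_one_Hm (m : ℝ) : pderiv (1 : Fin 2) (Hm m) = C 2 * X 1 := by
  simp only [Hm, map_sub, map_add, Derivation.leibniz_pow, pderiv_X_self, pderiv_C,
    pderiv_X_of_ne (show (0 : Fin 2) ≠ 1 by decide), smul_eq_mul, nsmul_eq_mul]
  simp only [map_ofNat]
  push_cast
  ring

theorem Hm_dvd_lieDerivative {m : ℝ} (hm : m ^ 2 = m) :
    Hm m ∣ pderiv (0 : Fin 2) (Hm m) * Pm m + pderiv (1 : Fin 2) (Hm m) * Qm m := by
  refine ⟨C 2 * X 0 * X 1 - C 4 * X 0 ^ 2 * (X 0 ^ 2 + C (m - 2)), ?_⟩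
  rw [pderiv_zero_Hm, pderiv_one_Hm, Pm_eq hm, Qm_eq hm]
  simp only [map_neg, map_ofNat]
  ring

theorem eval_Hm_eq_zero {m x : ℝ} (hx : x ^ 2 = 2 - m) : eval ![x, 0] (Hm m) = 0 := by
  simp [Hm, hx]

theorem eval_Pm_eq_zero {m x : ℝ} (hm : m ^ 2 = m) (hx : x ^ 2 = 2 - m) :
    eval ![x, 0] (Pm m) = 0 := by
  simp [Pm_eq hm, eval_Hm_eq_zero hx]

theorem eval_Qm_eq_zero {m x : ℝ} (hm : m ^ 2 = m) (hx : x ^ 2 = 2 - m) :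
    eval ![x, 0] (Qm m) = 0 := by
  simp [Qm_eq hm, eval_Hm_eq_zero hx, hx]

theorem algebraic_polycycle_example :
    ∀ m ∈ ({0, 1} : Set ℝ),
      (Hm m ∣ pderiv (0 : Fin 2) (Hm m) * Pm m + pderiv (1 : Fin 2) (Hm m) * Qm m) ∧
      (∀ x y : ℝ, eval ![x, y] (Hm m) = 0 →
        eval ![x, y] (pderiv (0 : Fin 2) (Hm m) * Pm m
          + pderiv (1 : Fin 2) (Hm m) * Qm m) = 0) ∧
      (∀ ε : ℝ, ε = 1 ∨ ε = -1 →
        eval ![ε * Real.sqrt (2 - m), 0] (Pm m) = 0 ∧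
        eval ![ε * Real.sqrt (2 - m), 0] (Qm m) = 0 ∧
        eval ![ε * Real.sqrt (2 - m), 0] (Hm m) = 0) := by
  intro m hmem
  have hm : m ^ 2 = m := by rcases hmem with rfl | rfl <;> norm_num
  have hm2 : 0 ≤ 2 - m := by rcases hmem with rfl | rfl <;> norm_num
  refine ⟨Hm_dvd_lieDerivative hm, fun x y h => ?_, fun ε hε => ?_⟩
  · exact zero_dvd_iff.mp (h ▸ map_dvd (eval ![x, y]) (Hm_dvd_lieDerivative hm))
  · have hx : (ε * Real.sqrt (2 - m)) ^ 2 = 2 - m := by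
      rcases hε with rfl | rfl <;> simp [Real.sq_sqrt hm2]
    exact ⟨eval_Pm_eq_zero hm hx, eval_Qm_eq_zero hm hx, eval_Hm_eq_zero hx⟩

end
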